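/- Let F : ℝ → ℝ be continuous with finite limits at ±∞. Let μ be a finite signed Borel measure on ℝ and set g(y) = μ((−∞, y]); assume g is Lebesgue integrable on ℝ. Then for every smooth compactly supported φ : ℝ → ℝ, −∫_ℝ ( ∫_ℝ F(x−y)g(y) dy ) φ′(x) dx = ∫_ℝ ( ∫_ℝ F(x−y) dμ(y) ) φ(x) dx; that is, the distributional derivative of F∗g is the function x ↦ ∫_ℝ F(x−y) dμ(y). -/

import Mathlib

open MeasureTheory Filter

/-- Integration of a real function against a finite signed Borel measure, defined as
the difference of the integrals against the positive and negative parts of the Jordan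
decomposition. -/
noncomputable def signedIntegral (μ : MeasureTheory.SignedMeasure ℝ) (f : ℝ → ℝ) : ℝ :=
  (∫ y, f y ∂μ.toJordanDecomposition.posPart) - ∫ y, f y ∂μ.toJordanDecomposition.negPart

lemma aux_parts (ν : Measure ℝ) [IsFiniteMeasure ν] (K K' : ℝ → ℝ)
    (hK : ∀ x, HasDerivAt K (K' x) x) (hK' : Continuous K') (a b : ℝ) (hab : a ≤ b) :
    ∫ y in a..b, K y ∂ν = K b * ν.real (Set.Iic b) - K a * ν.real (Set.Iic a)
      - ∫ t in a..b, K' t * ν.real (Set.Iic t) := by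
  have hIoc : ∀ t, a ≤ t → ν.real (Set.Ioc a t) = ν.real (Set.Iic t) - ν.real (Set.Iic a) := by
    intro t ht
    rw [← Set.Iic_sdiff_Iic, measureReal_sdiff (Set.Iic_subset_Iic.2 ht) measurableSet_Iic]
  have hmono : Monotone (fun t => ν.real (Set.Iic t)) := fun s t hst =>
    measureReal_mono (Set.Iic_subset_Iic.2 hst)
  have hKc : Continuous K := continuous_iff_continuousAt.2 fun x => (hK x).continuousAt
  have hK'i : IntegrableOn K' (Set.Ioc a b) := (hK'.integrableOn_Icc).mono_set Set.Ioc_subset_Icc_self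
  have hrep : ∀ y ∈ Set.Ioc a b, K y = K b - ∫ t in Set.Ioc a b, (Set.Ici y).indicator K' t := by
    intro y hy
    have h1 : ∫ t in y..b, K' t = K b - K y :=
      intervalIntegral.integral_eq_sub_of_hasDerivAt (fun x _ => hK x) (hK'.intervalIntegrable _ _)
    rw [intervalIntegral.integral_of_le hy.2] at h1
    have h2 : ∫ t in Set.Ioc a b, (Set.Ici y).indicator K' t = ∫ t in Set.Ioc y b, K' t := by
      rw [setIntegral_indicator measurableSet_Ici, ← integral_Icc_eq_integral_Ioc]
      congr 2
      ext t
      simp only [Set.mem_inter_iff, Set.mem_Ioc, Set.mem_Ici, Set.mem_Icc]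
      constructor
      · rintro ⟨h, h'⟩; exact ⟨h', h.2⟩
      · rintro ⟨h, h'⟩; exact ⟨⟨lt_of_lt_of_le hy.1 h, h'⟩, h⟩
    rw [h2, h1]; ring
  have hint : Integrable (Function.uncurry fun y t => (Set.Ici y).indicator K' t)
      ((ν.restrict (Set.Ioc a b)).prod (volume.restrict (Set.Ioc a b))) := by
    have : (Function.uncurry fun y t => (Set.Ici y).indicator K' t)
        = {p : ℝ × ℝ | p.1 ≤ p.2}.indicator (fun p => K' p.2) := by
      ext p
      simp [Function.uncurry, Set.indicator]
    rw [this]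
    exact (Integrable.comp_snd hK'i _).indicator (measurableSet_le measurable_fst measurable_snd)
  have hswap := integral_integral_swap hint
  have hpl : Integrable (fun y => ∫ t in Set.Ioc a b, (Set.Ici y).indicator K' t)
      (ν.restrict (Set.Ioc a b)) := hint.integral_prod_left
  have hin : ∀ t ∈ Set.Ioc a b, ∫ y in Set.Ioc a b, (Set.Ici y).indicator K' t ∂ν
      = K' t * ν.real (Set.Iic t) - K' t * ν.real (Set.Iic a) := by
    intro t ht
    have : (fun y => (Set.Ici y).indicator K' t) = (Set.Iic t).indicator (fun _ => K' t) := by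
      ext y; simp [Set.indicator]
    rw [this, setIntegral_indicator measurableSet_Iic, setIntegral_const]
    have : Set.Ioc a b ∩ Set.Iic t = Set.Ioc a t := by
      ext s
      simp only [Set.mem_inter_iff, Set.mem_Ioc, Set.mem_Iic]
      constructor
      · rintro ⟨h, h'⟩; exact ⟨h.1, h'⟩
      · rintro ⟨h, h'⟩; exact ⟨⟨h, h'.trans ht.2⟩, h'⟩
    rw [this, hIoc t ht.1.le, smul_eq_mul]; ring
  rw [intervalIntegral.integral_of_le hab, setIntegral_congr_fun measurableSet_Ioc hrep,
    integral_sub (integrable_const _) hpl, hswap,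
    setIntegral_congr_fun measurableSet_Ioc hin, setIntegral_const, hIoc b hab,
    ← intervalIntegral.integral_of_le hab, intervalIntegral.integral_sub
      (hmono.intervalIntegrable.continuousOn_mul hK'.continuousOn)
      ((hK'.intervalIntegrable _ _).mul_const _), intervalIntegral.integral_mul_const,
    intervalIntegral.integral_eq_sub_of_hasDerivAt (fun x _ => hK x) (hK'.intervalIntegrable _ _),
    smul_eq_mul]
  ring

lemma aux_mono (ν : Measure ℝ) [IsFiniteMeasure ν] : Monotone (fun t => ν.real (Set.Iic t)) :=
  fun _ _ hst => measureReal_mono (Set.Iic_subset_Iic.2 hst)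

lemma aux_bdd (F : ℝ → ℝ) (hF : Continuous F) (Fm Fp : ℝ)
    (hFm : Tendsto F atBot (nhds Fm)) (hFp : Tendsto F atTop (nhds Fp)) :
    ∃ C, ∀ x, ‖F x‖ ≤ C := by
  have h1 : ∀ᶠ x in atBot, ‖F x‖ < ‖Fm‖ + 1 := hFm.norm.eventually_lt_const (by linarith)
  have h2 : ∀ᶠ x in atTop, ‖F x‖ < ‖Fp‖ + 1 := hFp.norm.eventually_lt_const (by linarith)
  obtain ⟨a, ha⟩ := eventually_atBot.1 h1
  obtain ⟨b, hb⟩ := eventually_atTop.1 h2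
  obtain ⟨C, hC⟩ := (isCompact_Icc (a := a) (b := b)).exists_bound_of_continuousOn hF.continuousOn
  refine ⟨max C (max (‖Fm‖ + 1) (‖Fp‖ + 1)), fun x => ?_⟩
  rcases le_total x a with h | h
  · exact (ha x h).le.trans ((le_max_left _ _).trans (le_max_right _ _))
  rcases le_total b x with h' | h'
  · exact (hb x h').le.trans ((le_max_right _ _).trans (le_max_right _ _))
  · exact (hC x ⟨h, h'⟩).trans (le_max_left _ _)

lemma aux_fubini (F : ℝ → ℝ) (hF : Continuous F) (C : ℝ) (hC : ∀ x, ‖F x‖ ≤ C)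
    (ν : Measure ℝ) [SFinite ν] (w φ : ℝ → ℝ) (hw : Integrable w ν) (hφ : Integrable φ) :
    Integrable (fun x => (∫ y, F (x - y) * w y ∂ν) * φ x) ∧
    ∫ x, (∫ y, F (x - y) * w y ∂ν) * φ x = ∫ y, (∫ x, F (x - y) * φ x) * w y ∂ν := by
  have hint : Integrable (Function.uncurry fun x y => F (x - y) * (φ x * w y))
      (volume.prod ν) := by
    apply Integrable.bdd_mul (c := C) (hφ.mul_prod hw)
    · exact (hF.comp (continuous_fst.sub continuous_snd)).aestronglyMeasurable
    · exact Eventually.of_forall fun p => hC _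
  have e : ∀ x, (∫ y, F (x - y) * w y ∂ν) * φ x = ∫ y, F (x - y) * (φ x * w y) ∂ν := by
    intro x
    rw [← integral_mul_const]
    congr 1; ext y; ring
  have e' : ∀ y, (∫ x, F (x - y) * φ x) * w y = ∫ x, F (x - y) * (φ x * w y) := by
    intro y
    rw [← integral_mul_const]
    congr 1; ext y; ring
  simp_rw [e, e']
  exact ⟨hint.integral_prod_left, integral_integral_swap hint⟩

/-- Let `F : ℝ → ℝ` be continuous with finite limits at `±∞`, let `μ` be a finite signed
Borel measure on `ℝ` and `g(y) = μ((-∞, y])` be Lebesgue integrable.  Then the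
distributional derivative of `F ∗ g` is `x ↦ ∫ F(x-y) dμ(y)`: for every test function
`φ`, `-∫ (F ∗ g)(x) φ'(x) dx = ∫ (∫ F(x-y) dμ(y)) φ(x) dx`. -/
theorem distributional_derivative_of_convolution
    (F : ℝ → ℝ) (hF : Continuous F) (Fm Fp : ℝ)
    (hFm : Tendsto F atBot (nhds Fm)) (hFp : Tendsto F atTop (nhds Fp))
    (μ : MeasureTheory.SignedMeasure ℝ)
    (g : ℝ → ℝ) (hg : ∀ y, g y = μ (Set.Iic y)) (hgint : Integrable g) :
    ∀ φ : ℝ → ℝ, ContDiff ℝ (⊤ : ℕ∞) φ → HasCompactSupport φ →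
      -∫ x, (∫ y, F (x - y) * g y) * deriv φ x =
        ∫ x, signedIntegral μ (fun y => F (x - y)) * φ x := by
  intro φ hφ hφc
  obtain ⟨C, hC⟩ := aux_bdd F hF Fm Fp hFm hFp
  set P := μ.toJordanDecomposition.posPart with hP
  set N := μ.toJordanDecomposition.negPart with hN
  have hgPN : ∀ y, g y = P.real (Set.Iic y) - N.real (Set.Iic y) := by
    intro y
    rw [hg y]
    conv_lhs => rw [← SignedMeasure.toSignedMeasure_toJordanDecomposition μ]
    rw [JordanDecomposition.toSignedMeasure, _root_.sub_apply,
      Measure.toSignedMeasure_apply_measurable measurableSet_Iic,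
      Measure.toSignedMeasure_apply_measurable measurableSet_Iic]
  have hφi : Integrable φ := hφ.continuous.integrable_of_hasCompactSupport hφc
  have hφ1 : ContDiff ℝ 1 φ := hφ.of_le (by exact_mod_cast le_top)
  have hdc : Continuous (deriv φ) := hφ1.continuous_deriv le_rfl
  have hdi : Integrable (deriv φ) := hdc.integrable_of_hasCompactSupport hφc.deriv
  -- the smooth function K
  set K : ℝ → ℝ := fun y => ∫ x, F (x - y) * φ x with hKdef
  set K' : ℝ → ℝ := fun y => ∫ x, F (x - y) * deriv φ x with hK'def
  have hconv : ∀ ψ : ℝ → ℝ, (fun y => ∫ x, F (x - y) * ψ x) =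
      convolution (fun t => F (-t)) ψ (ContinuousLinearMap.mul ℝ ℝ) volume := by
    intro ψ
    ext y
    rw [convolution, ← integral_sub_left_eq_self _ volume y]
    congr 1; ext t
    simp
  have hFn : Continuous fun t => F (-t) := hF.comp continuous_neg
  have hK : ∀ y, HasDerivAt K (K' y) y := by
    intro y
    rw [hKdef, hK'def, hconv φ, hconv (deriv φ)]
    exact hφc.hasDerivAt_convolution_right _ hFn.locallyIntegrable hφ1 y
  have hK'c : Continuous K' := by
    rw [hK'def, hconv (deriv φ)]
    exact hφc.deriv.continuous_convolution_right _ hFn.locallyIntegrable hdc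
  have hKc : Continuous K := continuous_iff_continuousAt.2 fun x => (hK x).continuousAt
  have hbd : ∀ ψ : ℝ → ℝ, Integrable ψ → ∀ y, ‖∫ x, F (x - y) * ψ x‖ ≤ ∫ x, C * ‖ψ x‖ := by
    intro ψ hψ y
    refine norm_integral_le_of_norm_le (hψ.norm.const_mul C) (Eventually.of_forall fun x => ?_)
    rw [norm_mul]
    exact mul_le_mul_of_nonneg_right (hC _) (norm_nonneg _)
  have hKi : ∀ ν : Measure ℝ, IsFiniteMeasure ν → Integrable K ν := fun ν _ =>
    Integrable.of_bound hKc.aestronglyMeasurable _ (Eventually.of_forall (hbd φ hφi))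
  have hK'g : Integrable (fun t => K' t * g t) :=
    hgint.bdd_mul hK'c.aestronglyMeasurable (Eventually.of_forall (hbd _ hdi))
  -- rewrite both sides
  have hL : ∫ x, (∫ y, F (x - y) * g y) * deriv φ x = ∫ t, K' t * g t :=
    (aux_fubini F hF C hC volume g (deriv φ) hgint hdi).2
  have hone : ∀ ν : Measure ℝ, IsFiniteMeasure ν →
      Integrable (fun x => (∫ y, F (x - y) ∂ν) * φ x) ∧
      ∫ x, (∫ y, F (x - y) ∂ν) * φ x = ∫ y, K y ∂ν := by
    intro ν _
    have := aux_fubini F hF C hC ν (fun _ => 1) φ (integrable_const _) hφi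
    simpa using this
  have hR : ∫ x, signedIntegral μ (fun y => F (x - y)) * φ x = ∫ y, K y ∂P - ∫ y, K y ∂N := by
    rw [← (hone P inferInstance).2, ← (hone N inferInstance).2,
      ← integral_sub (hone P inferInstance).1 (hone N inferInstance).1]
    congr 1; ext x
    rw [signedIntegral, sub_mul]
  rw [hL, hR]
  -- limits of g
  have htop : Tendsto g atTop (nhds 0) := by
    have hb : ∀ ν : Measure ℝ, IsFiniteMeasure ν →
        ∃ l, Tendsto (fun t => ν.real (Set.Iic t)) atTop (nhds l) := fun ν _ =>
      ⟨_, tendsto_atTop_ciSup (aux_mono ν)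
        ⟨ν.real Set.univ, by rintro _ ⟨t, rfl⟩; exact measureReal_mono (Set.subset_univ _)⟩⟩
    obtain ⟨l, hl⟩ := hb P inferInstance
    obtain ⟨l', hl'⟩ := hb N inferInstance
    have h := (hl.sub hl').congr fun t => (hgPN t).symm
    have h0 := IntegrableAtFilter.eq_zero_of_tendsto (hgint.integrableAtFilter atTop) (by
      intro s hs
      rcases mem_atTop_sets.1 hs with ⟨b, hb⟩
      rw [← top_le_iff, ← Real.volume_Ici (a := b)]
      exact measure_mono hb) h
    rwa [h0] at h
  have hbot : Tendsto g atBot (nhds 0) := by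
    have hb : ∀ ν : Measure ℝ, IsFiniteMeasure ν →
        ∃ l, Tendsto (fun t => ν.real (Set.Iic t)) atBot (nhds l) := fun ν _ =>
      ⟨_, tendsto_atBot_ciInf (aux_mono ν)
        ⟨0, by rintro _ ⟨t, rfl⟩; exact measureReal_nonneg⟩⟩
    obtain ⟨l, hl⟩ := hb P inferInstance
    obtain ⟨l', hl'⟩ := hb N inferInstance
    have h := (hl.sub hl').congr fun t => (hgPN t).symm
    have h0 := IntegrableAtFilter.eq_zero_of_tendsto (hgint.integrableAtFilter atBot) (by
      intro s hs
      rcases mem_atBot_sets.1 hs with ⟨b, hb⟩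
      rw [← top_le_iff, ← Real.volume_Iic (a := b)]
      exact measure_mono hb) h
    rwa [h0] at h
  -- integration by parts on [-R, R]
  have hparts : ∀ R : ℝ, 0 ≤ R →
      K R * g R - K (-R) * g (-R) - ∫ t in (-R)..R, K' t * g t =
      (∫ y in (-R)..R, K y ∂P) - ∫ y in (-R)..R, K y ∂N := by
    intro R hR
    have hii : ∀ ν : Measure ℝ, IsFiniteMeasure ν →
        IntervalIntegrable (fun t => K' t * ν.real (Set.Iic t)) volume (-R) R := fun ν _ =>
      (aux_mono ν).intervalIntegrable.continuousOn_mul hK'c.continuousOn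
    have hs : ∫ t in (-R)..R, K' t * g t = (∫ t in (-R)..R, K' t * P.real (Set.Iic t))
        - ∫ t in (-R)..R, K' t * N.real (Set.Iic t) := by
      rw [← intervalIntegral.integral_sub (hii P inferInstance) (hii N inferInstance)]
      congr 1; ext t
      rw [hgPN]; ring
    rw [aux_parts P K K' hK hK'c _ _ (by linarith), aux_parts N K K' hK hK'c _ _ (by linarith),
      hs, hgPN, hgPN]
    ring
  have hbK : ∀ u : ℝ → ℝ, Tendsto (fun R => g (u R)) atTop (nhds 0) →
      Tendsto (fun R => K (u R) * g (u R)) atTop (nhds 0) := by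
    intro u hu
    refine squeeze_zero_norm (a := fun R => (∫ x, C * ‖φ x‖) * ‖g (u R)‖) (fun R => ?_) ?_
    · rw [norm_mul]
      exact mul_le_mul_of_nonneg_right (hbd φ hφi _) (norm_nonneg _)
    · simpa using hu.norm.const_mul (∫ x, C * ‖φ x‖)
  have t1 := ((hbK id htop).sub (hbK (fun R => -R) (hbot.comp tendsto_neg_atTop_atBot))).sub
    (intervalIntegral_tendsto_integral hK'g tendsto_neg_atTop_atBot tendsto_id)
  have t2 := (intervalIntegral_tendsto_integral (hKi P inferInstance)
    tendsto_neg_atTop_atBot tendsto_id).sub (intervalIntegral_tendsto_integral (hKi N inferInstance)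
    tendsto_neg_atTop_atBot tendsto_id)
  have t3 := t1.congr' ((eventually_ge_atTop (0 : ℝ)).mono fun R hR => hparts R hR)
  have := tendsto_nhds_unique t3 t2
  linarith
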